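/- arXiv:2509.13063 — 6 statements merged into one kernel-verified Lean document; each statement's English description precedes it below -/
import Mathlib

section
/- Let R be the ternary relation on finite binary words defined as follows: for X, Y, Z ∈ {0,1}*, R(X,Y,Z) holds if and only if there exists an odd positive integer i with i+1 ≤ |X|, |Y|, |Z| such that the set of pairs {X_i X_{i+1}, Y_i Y_{i+1}, Z_i Z_{i+1}} equals {00, 01, 10}. Then there do not exist finite index sets I₁, I₂, I₃ and, for each index i, regular languages A_i^1, …, A_i^5 ⊆ {0,1}*, such that R equals the union over i ∈ I₁ of the relations R_i^1 = {(a₁a₂, a₁a₃a₄, a₁a₃a₅) : a₁ ∈ A_i^1, a₂ ∈ A_i^2, a₃ ∈ A_i^3, a₄ ∈ A_i^4, a₅ ∈ A_i^5}, together with the union over i ∈ I₂ of the relations R_i^2 = {(a₁a₃a₄, a₁a₂, a₁a₃a₅) : a_j ∈ A_i^j}, together with the union over i ∈ I₃ of the relations R_i^3 = {(a₁a₃a₄, a₁a₃a₅, a₁a₂) : a_j ∈ A_i^j}. -/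
/-- The pair of symbols of the word `w` at (1-indexed) positions `i` and `i+1`. -/
def pairAt (w : List (Fin 2)) (i : ℕ) : Fin 2 × Fin 2 :=
  (w.getD (i - 1) 0, w.getD i 0)

/-- The relation `R` on finite binary words: `R X Y Z` holds iff there is an odd positive
integer `i` with `i + 1 ≤ |X|, |Y|, |Z|` such that the set of pairs
`{XᵢXᵢ₊₁, YᵢYᵢ₊₁, ZᵢZᵢ₊₁}` equals `{00, 01, 10}`. -/
def Rrel (X Y Z : List (Fin 2)) : Prop :=
  ∃ i : ℕ, Odd i ∧ 0 < i ∧ i + 1 ≤ X.length ∧ i + 1 ≤ Y.length ∧ i + 1 ≤ Z.length ∧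
    ({pairAt X i, pairAt Y i, pairAt Z i} : Set (Fin 2 × Fin 2)) =
      {((0 : Fin 2), (0 : Fin 2)), (0, 1), (1, 0)}

/-- Special relation of type 1 built from component languages `A 0, …, A 4`. -/
def SpecRel1 (A : Fin 5 → Set (List (Fin 2))) (X Y Z : List (Fin 2)) : Prop :=
  ∃ a₁ ∈ A 0, ∃ a₂ ∈ A 1, ∃ a₃ ∈ A 2, ∃ a₄ ∈ A 3, ∃ a₅ ∈ A 4,
    X = a₁ ++ a₂ ∧ Y = a₁ ++ a₃ ++ a₄ ∧ Z = a₁ ++ a₃ ++ a₅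

/-- Special relation of type 2 built from component languages `A 0, …, A 4`. -/
def SpecRel2 (A : Fin 5 → Set (List (Fin 2))) (X Y Z : List (Fin 2)) : Prop :=
  ∃ a₁ ∈ A 0, ∃ a₂ ∈ A 1, ∃ a₃ ∈ A 2, ∃ a₄ ∈ A 3, ∃ a₅ ∈ A 4,
    X = a₁ ++ a₃ ++ a₄ ∧ Y = a₁ ++ a₂ ∧ Z = a₁ ++ a₃ ++ a₅

/-- Special relation of type 3 built from component languages `A 0, …, A 4`. -/
def SpecRel3 (A : Fin 5 → Set (List (Fin 2))) (X Y Z : List (Fin 2)) : Prop :=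
  ∃ a₁ ∈ A 0, ∃ a₂ ∈ A 1, ∃ a₃ ∈ A 2, ∃ a₄ ∈ A 3, ∃ a₅ ∈ A 4,
    X = a₁ ++ a₃ ++ a₄ ∧ Y = a₁ ++ a₃ ++ a₅ ∧ Z = a₁ ++ a₂

def wX (n : ℕ) : List (Fin 2) := 0 :: 0 :: List.replicate (2 * n + 2) 0
def wY (n : ℕ) : List (Fin 2) := 1 :: 1 :: (List.replicate (2 * n + 1) 0 ++ [1])
def wZ (n : ℕ) : List (Fin 2) := 0 :: 1 :: (List.replicate (2 * n) 0 ++ [1, 0])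

lemma wX_getD (n k : ℕ) : (wX n).getD k 0 = 0 := by
  rcases k with _ | _ | k
  · simp [wX]
  · simp [wX]
  · simp only [wX, List.getD_eq_getElem?_getD, List.getElem?_replicate,
      List.getElem?_cons]
    grind

lemma wY_getD (n k : ℕ) :
    (wY n).getD k 0 = if k = 0 ∨ k = 1 ∨ k = 2 * n + 3 then 1 else 0 := by
  rcases k with _ | _ | k
  · simp [wY]
  · simp [wY]
  · simp only [wY, List.getD_eq_getElem?_getD, List.getElem?_append,
      List.getElem?_replicate, List.length_replicate, List.getElem?_cons]
    grind

lemma wZ_getD (n k : ℕ) :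
    (wZ n).getD k 0 = if k = 1 ∨ k = 2 * n + 2 then 1 else 0 := by
  rcases k with _ | _ | k
  · simp [wZ]
  · simp [wZ]
  · simp only [wZ, List.getD_eq_getElem?_getD, List.getElem?_append,
      List.getElem?_replicate, List.length_replicate, List.getElem?_cons]
    grind

lemma R_diag (n : ℕ) : Rrel (wX n) (wY n) (wZ n) := by
  refine ⟨2 * n + 3, ⟨n + 1, by ring⟩, by omega, by simp [wX], by simp [wY], by simp [wZ], ?_⟩
  simp only [pairAt, wX_getD, wY_getD, wZ_getD]
  simp

lemma R_mixed {n m : ℕ} (h : Rrel (wX n) (wY m) (wZ n)) : n = m := by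
  obtain ⟨i, ⟨k, hk⟩, -, -, -, -, h⟩ := h
  subst hk
  have h01 : ((0 : Fin 2), (1 : Fin 2)) ∈
      ({((0 : Fin 2), (0 : Fin 2)), (0, 1), (1, 0)} : Set (Fin 2 × Fin 2)) := by simp
  have h10 : ((1 : Fin 2), (0 : Fin 2)) ∈
      ({((0 : Fin 2), (0 : Fin 2)), (0, 1), (1, 0)} : Set (Fin 2 × Fin 2)) := by simp
  rw [← h] at h01 h10
  simp only [pairAt, wX_getD, wY_getD, wZ_getD, Set.mem_insert_iff, Set.mem_singleton_iff,
    Prod.mk.injEq] at h01 h10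
  grind

/-- Two words with distinct first letters have only the empty common prefix. -/
lemma pre_nil {p u v s t : List (Fin 2)} {a b : Fin 2} (hab : a ≠ b)
    (h1 : a :: s = p ++ u) (h2 : b :: t = p ++ v) : p = [] := by
  cases p with
  | nil => rfl
  | cons c p =>
    simp only [List.cons_append, List.cons.injEq] at h1 h2
    exact absurd (h1.1.trans h2.1.symm) hab

lemma mix1 {A : Fin 5 → Set (List (Fin 2))} {n m : ℕ}
    (hn : SpecRel1 A (wX n) (wY n) (wZ n)) (hm : SpecRel1 A (wX m) (wY m) (wZ m)) :
    SpecRel1 A (wX n) (wY m) (wZ n) := by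
  obtain ⟨a₁, h1, a₂, h2, a₃, h3, a₄, h4, a₅, h5, hX, hY, hZ⟩ := hn
  obtain ⟨b₁, g1, b₂, g2, b₃, g3, b₄, g4, b₅, g5, gX, gY, gZ⟩ := hm
  have e := pre_nil (by decide) hY hZ
  have f := pre_nil (by decide) gY gZ
  rw [List.append_eq_nil_iff] at e f
  obtain ⟨rfl, rfl⟩ := e
  obtain ⟨rfl, rfl⟩ := f
  exact ⟨[], h1, a₂, h2, [], h3, b₄, g4, a₅, h5, hX, gY, hZ⟩

lemma mix2 {A : Fin 5 → Set (List (Fin 2))} {n m : ℕ}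
    (hn : SpecRel2 A (wX n) (wY n) (wZ n)) (hm : SpecRel2 A (wX m) (wY m) (wZ m)) :
    SpecRel2 A (wX n) (wY m) (wZ n) := by
  obtain ⟨a₁, h1, a₂, h2, a₃, h3, a₄, h4, a₅, h5, hX, hY, hZ⟩ := hn
  obtain ⟨b₁, g1, b₂, g2, b₃, g3, b₄, g4, b₅, g5, gX, gY, gZ⟩ := hm
  have e := pre_nil (by decide) hY (hX.trans (List.append_assoc _ _ _))
  have f := pre_nil (by decide) gY (gX.trans (List.append_assoc _ _ _))
  subst e f
  exact ⟨[], h1, b₂, g2, a₃, h3, a₄, h4, a₅, h5, hX, gY, hZ⟩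

lemma mix3 {A : Fin 5 → Set (List (Fin 2))} {n m : ℕ}
    (hn : SpecRel3 A (wX n) (wY n) (wZ n)) (hm : SpecRel3 A (wX m) (wY m) (wZ m)) :
    SpecRel3 A (wX n) (wY m) (wZ n) := by
  obtain ⟨a₁, h1, a₂, h2, a₃, h3, a₄, h4, a₅, h5, hX, hY, hZ⟩ := hn
  obtain ⟨b₁, g1, b₂, g2, b₃, g3, b₄, g4, b₅, g5, gX, gY, gZ⟩ := hm
  have e := pre_nil (by decide) hX hY
  have f := pre_nil (by decide) gX gY
  rw [List.append_eq_nil_iff] at e f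
  obtain ⟨rfl, rfl⟩ := e
  obtain ⟨rfl, rfl⟩ := f
  exact ⟨[], h1, a₂, h2, [], h3, a₄, h4, b₅, g5, hX, gY, hZ⟩

/-- The relation `R` is not a finite union of special relations with regular components. -/
theorem Rrel_not_finite_union_of_special_regular :
    ¬ ∃ (n₁ n₂ n₃ : ℕ)
        (A : Fin n₁ → Fin 5 → Set (List (Fin 2)))
        (B : Fin n₂ → Fin 5 → Set (List (Fin 2)))
        (C : Fin n₃ → Fin 5 → Set (List (Fin 2))),
      (∀ i j, Language.IsRegular (A i j : Language (Fin 2))) ∧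
      (∀ i j, Language.IsRegular (B i j : Language (Fin 2))) ∧
      (∀ i j, Language.IsRegular (C i j : Language (Fin 2))) ∧
      (∀ X Y Z : List (Fin 2), Rrel X Y Z ↔
        ((∃ i, SpecRel1 (A i) X Y Z) ∨ (∃ i, SpecRel2 (B i) X Y Z) ∨
          (∃ i, SpecRel3 (C i) X Y Z))) := by
  rintro ⟨n₁, n₂, n₃, A, B, C, -, -, -, H⟩
  have key : ∀ n : ℕ, ∃ c : Fin n₁ ⊕ Fin n₂ ⊕ Fin n₃,
      Sum.elim (fun i => SpecRel1 (A i) (wX n) (wY n) (wZ n))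
        (Sum.elim (fun i => SpecRel2 (B i) (wX n) (wY n) (wZ n))
          (fun i => SpecRel3 (C i) (wX n) (wY n) (wZ n))) c := by
    intro n
    rcases (H _ _ _).1 (R_diag n) with ⟨i, h⟩ | ⟨i, h⟩ | ⟨i, h⟩
    · exact ⟨Sum.inl i, h⟩
    · exact ⟨Sum.inr (Sum.inl i), h⟩
    · exact ⟨Sum.inr (Sum.inr i), h⟩
  choose f hf using key
  obtain ⟨n, m, hne, hfm⟩ := Finite.exists_ne_map_eq_of_infinite f
  apply hne
  apply R_mixed
  rw [H]
  have hn := hf n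
  have hm := hf m
  rw [← hfm] at hm
  generalize f n = c at hn hm
  rcases c with i | i | i
  · exact Or.inl ⟨i, mix1 hn hm⟩
  · exact Or.inr (Or.inl ⟨i, mix2 hn hm⟩)
  · exact Or.inr (Or.inr ⟨i, mix3 hn hm⟩)
end

section
/- Let R be the ternary relation on finite binary words defined as follows: for X, Y, Z ∈ {0,1}*, R(X,Y,Z) holds if and only if there exists an odd positive integer i with i+1 ≤ |X|, |Y|, |Z| such that the set of pairs {X_i X_{i+1}, Y_i Y_{i+1}, Z_i Z_{i+1}} equals {00, 01, 10}. Then there do not exist finite index sets I₁, I₂, I₃ and, for each index i, arbitrary sets of binary words A_i^1, …, A_i^5 ⊆ {0,1}* (no regularity assumed), such that R equals the union over i ∈ I₁ of the relations R_i^1 = {(a₁a₂, a₁a₃a₄, a₁a₃a₅) : a₁ ∈ A_i^1, a₂ ∈ A_i^2, a₃ ∈ A_i^3, a₄ ∈ A_i^4, a₅ ∈ A_i^5}, together with the union over i ∈ I₂ of the relations R_i^2 = {(a₁a₃a₄, a₁a₂, a₁a₃a₅) : a_j ∈ A_i^j}, together with the union over i ∈ I₃ of the relations R_i^3 = {(a₁a₃a₄,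 a₁a₃a₅, a₁a₂) : a_j ∈ A_i^j}. -/
/-- Test words: a first block, `k` neutral blocks `11`, and a last block. -/
def tw (a b c d : Fin 2) (k : ℕ) : List (Fin 2) :=
  a :: b :: (List.replicate (2 * k) 1 ++ [c, d])

theorem tw_length (a b c d : Fin 2) (k : ℕ) : (tw a b c d k).length = 2 * k + 4 := by
  simp [tw]

theorem tw_last (a b c d : Fin 2) (k : ℕ) : pairAt (tw a b c d k) (2 * k + 3) = (c, d) := by
  have h1 : 2 * k + 3 - 1 = (2 * k) + 1 + 1 := by omega
  have h2 : 2 * k + 3 = (2 * k + 1) + 1 + 1 := by omega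
  simp only [pairAt, tw, h1]
  rw [h2]
  simp only [List.getD_cons_succ]
  rw [List.getD_append_right _ _ _ _ (by simp), List.getD_append_right _ _ _ _ (by simp)]
  simp

theorem tw_mid (a b c d : Fin 2) (k i : ℕ) (ho : Odd i) (hl : i + 1 ≤ 2 * k + 4) :
    i = 1 ∨ i = 2 * k + 3 ∨ pairAt (tw a b c d k) i = (1, 1) := by
  obtain ⟨m, rfl⟩ := ho
  rcases m with _ | m
  · left; rfl
  · by_cases h : m = k
    · right; left; omega
    · right; right
      have h1 : 2 * (m + 1) + 1 - 1 = (2 * m) + 1 + 1 := by omega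
      have h2 : 2 * (m + 1) + 1 = (2 * m + 1) + 1 + 1 := by omega
      simp only [pairAt, tw, h1]
      rw [h2]
      simp only [List.getD_cons_succ]
      rw [List.getD_append _ _ _ _ (by simp; omega), List.getD_append _ _ _ _ (by simp; omega)]
      rw [List.getD_replicate _ (by omega), List.getD_replicate _ (by omega)]

theorem tw_pos (k : ℕ) : Rrel (tw 1 1 0 0 k) (tw 0 0 0 1 k) (tw 0 1 1 0 k) := by
  refine ⟨2 * k + 3, ⟨k + 1, by ring⟩, by omega, ?_, ?_, ?_, ?_⟩
  · rw [tw_length]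
  · rw [tw_length]
  · rw [tw_length]
  · rw [tw_last, tw_last, tw_last]

theorem tw_neg (p q r : ℕ) (h : Rrel (tw 1 1 0 0 p) (tw 0 0 0 1 q) (tw 0 1 1 0 r)) :
    p = q ∧ p = r := by
  obtain ⟨i, ho, -, hX, hY, hZ, hs⟩ := h
  rw [tw_length] at hX hY hZ
  have key : ∀ x, x ∈ ({pairAt (tw 1 1 0 0 p) i, pairAt (tw 0 0 0 1 q) i,
      pairAt (tw 0 1 1 0 r) i} : Set (Fin 2 × Fin 2)) → x ≠ (1, 1) := by
    intro x hx
    rw [hs] at hx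
    rintro rfl
    simp at hx
  have kX := key _ (Or.inl rfl)
  have kY := key _ (Or.inr (Or.inl rfl))
  have kZ := key _ (Or.inr (Or.inr rfl))
  have h1 : i ≠ 1 := by
    rintro rfl
    exact kX rfl
  have eX := tw_mid 1 1 0 0 p i ho hX
  have eY := tw_mid 0 0 0 1 q i ho hY
  have eZ := tw_mid 0 1 1 0 r i ho hZ
  simp only [h1, kX, kY, kZ, false_or, or_false] at eX eY eZ
  omega

theorem tw_nil (a b c b' c' d d' : Fin 2) (k l : ℕ) (u v w : List (Fin 2))
    (h : tw 1 b c d k = u ++ v) (h' : tw 0 b' c' d' l = u ++ w) : u = [] := by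
  rcases u with _ | ⟨x, u⟩
  · rfl
  · simp only [tw, List.cons_append, List.cons.injEq] at h h'
    exact absurd (h.1.trans h'.1.symm) (by decide)

/-- The relation `R` is not a finite union of special relations, even with arbitrary (not necessarily regular) components. -/
theorem Rrel_not_finite_union_of_special :
    ¬ ∃ (n₁ n₂ n₃ : ℕ)
        (A : Fin n₁ → Fin 5 → Set (List (Fin 2)))
        (B : Fin n₂ → Fin 5 → Set (List (Fin 2)))
        (C : Fin n₃ → Fin 5 → Set (List (Fin 2))),
      (∀ X Y Z : List (Fin 2), Rrel X Y Z ↔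
        ((∃ i, SpecRel1 (A i) X Y Z) ∨ (∃ i, SpecRel2 (B i) X Y Z) ∨
          (∃ i, SpecRel3 (C i) X Y Z))) := by
  rintro ⟨n₁, n₂, n₃, A, B, C, H⟩
  have ex : ∀ k : ℕ, ∃ s : Fin n₁ ⊕ Fin n₂ ⊕ Fin n₃,
      Sum.elim (fun i => SpecRel1 (A i)) (Sum.elim (fun i => SpecRel2 (B i))
        (fun i => SpecRel3 (C i))) s (tw 1 1 0 0 k) (tw 0 0 0 1 k) (tw 0 1 1 0 k) := by
    intro k
    rcases (H _ _ _).1 (tw_pos k) with ⟨i, h⟩ | ⟨i, h⟩ | ⟨i, h⟩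
    · exact ⟨Sum.inl i, h⟩
    · exact ⟨Sum.inr (Sum.inl i), h⟩
    · exact ⟨Sum.inr (Sum.inr i), h⟩
  choose f hf using ex
  obtain ⟨k, l, hkl, he⟩ := Finite.exists_ne_map_eq_of_infinite f
  have hk := hf k
  have hl := hf l
  rw [← he] at hl
  rcases hfk : f k with i | i | i
  all_goals
    rw [hfk] at hk hl
    simp only [Sum.elim_inl, Sum.elim_inr] at hk hl
    obtain ⟨a₁, m₁, a₂, m₂, a₃, m₃, a₄, m₄, a₅, m₅, eX, eY, eZ⟩ := hk
    obtain ⟨b₁, p₁, b₂, p₂, b₃, p₃, b₄, p₄, b₅, p₅, fX, fY, fZ⟩ := hl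
    simp only [List.append_assoc] at eX eY eZ fX fY fZ
    obtain rfl := tw_nil 0 _ _ _ _ _ _ _ _ _ _ _ eX eY
    obtain rfl := tw_nil 0 _ _ _ _ _ _ _ _ _ _ _ fX fY
    simp only [List.nil_append] at eX eY eZ fX fY fZ
  · have := (H (tw 1 1 0 0 k) (tw 0 0 0 1 l) (tw 0 1 1 0 l)).2 (Or.inl ⟨i, [], m₁, a₂, m₂,
      b₃, p₃, b₄, p₄, b₅, p₅, by simpa using eX, by simpa using fY, by simpa using fZ⟩)
    exact hkl (tw_neg _ _ _ this).1
  · have := (H (tw 1 1 0 0 l) (tw 0 0 0 1 k) (tw 0 1 1 0 l)).2 (Or.inr (Or.inl ⟨i, [], m₁, a₂, m₂,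
      b₃, p₃, b₄, p₄, b₅, p₅, by simpa using fX, by simpa using eY, by simpa using fZ⟩))
    exact hkl (tw_neg _ _ _ this).1.symm
  · have := (H (tw 1 1 0 0 l) (tw 0 0 0 1 l) (tw 0 1 1 0 k)).2 (Or.inr (Or.inr ⟨i, [], m₁, a₂, m₂,
      b₃, p₃, b₄, p₄, b₅, p₅, by simpa using fX, by simpa using fY, by simpa using eZ⟩))
    exact hkl (tw_neg _ _ _ this).2.symm
end

section
/- For all integers n, n', ℓ with n ≠ n', ℓ > n ≥ 0 and ℓ > n' ≥ 0, define the binary words X^{n',ℓ} = (00)^{n'} (01) (00)^{ℓ−n'−1}, Y^{n,ℓ} = (10)^n (00) (00)^{ℓ−n−1}, and Z^{n,ℓ} = (10)^n (10) (00)^{ℓ−n−1}. Then R(X^{n',ℓ}, Y^{n,ℓ}, Z^{n,ℓ}) does NOT hold, i.e., there is no odd positive integer i with i+1 ≤ 2ℓ such that the set of pairs {X^{n',ℓ}_i X^{n',ℓ}_{i+1}, Y^{n,ℓ}_i Y^{n,ℓ}_{i+1}, Z^{n,ℓ}_i Z^{n,ℓ}_{i+1}} equals {00, 01, 10}. -/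
/-- `X^{n,ℓ} = (00)^n (01) (00)^{ℓ-n-1}`. -/
def Xword (n ℓ : ℕ) : List (Fin 2) :=
  (List.replicate n ([0, 0] : List (Fin 2))).flatten ++ [0, 1] ++
    (List.replicate (ℓ - n - 1) ([0, 0] : List (Fin 2))).flatten

/-- `Y^{n,ℓ} = (10)^n (00) (00)^{ℓ-n-1}`. -/
def Yword (n ℓ : ℕ) : List (Fin 2) :=
  (List.replicate n ([1, 0] : List (Fin 2))).flatten ++ [0, 0] ++
    (List.replicate (ℓ - n - 1) ([0, 0] : List (Fin 2))).flatten

/-- `Z^{n,ℓ} = (10)^n (10) (00)^{ℓ-n-1}`. -/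
def Zword (n ℓ : ℕ) : List (Fin 2) :=
  (List.replicate n ([1, 0] : List (Fin 2))).flatten ++ [1, 0] ++
    (List.replicate (ℓ - n - 1) ([0, 0] : List (Fin 2))).flatten

theorem pairAt_zeros (m k : ℕ) :
    pairAt (List.replicate m ([0, 0] : List (Fin 2))).flatten (2 * k + 1) = (0, 0) := by
  induction m generalizing k with
  | zero => simp [pairAt]
  | succ m ih =>
    cases k with
    | zero => simp [pairAt, List.replicate_succ]
    | succ k =>
      have h := ih k
      simpa [pairAt, List.replicate_succ, Nat.mul_add] using h

theorem pairAt_blocks (a b c d : Fin 2) (n m k : ℕ) :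
    pairAt ((List.replicate n [a, b]).flatten ++ [c, d] ++
      (List.replicate m ([0, 0] : List (Fin 2))).flatten) (2 * k + 1) =
      if k < n then (a, b) else if k = n then (c, d) else (0, 0) := by
  induction n generalizing k with
  | zero =>
    cases k with
    | zero => simp [pairAt]
    | succ k =>
      have h := pairAt_zeros m k
      simpa [pairAt, Nat.mul_add] using h
  | succ n ih =>
    cases k with
    | zero => simp [pairAt, List.replicate_succ]
    | succ k =>
      have h := ih k
      simpa [pairAt, List.replicate_succ, Nat.mul_add] using h

/-- For `n ≠ n'` (both `< ℓ`), the mixed triple `(X^{n',ℓ}, Y^{n,ℓ}, Z^{n,ℓ})`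
does not satisfy `R`: no odd positive `i` with `i + 1 ≤ 2ℓ` witnesses the pair set
`{00, 01, 10}`. -/
theorem not_Rrel_of_mixed_diagonal_words (n n' ℓ : ℕ) (hne : n ≠ n')
    (hnl : n < ℓ) (hn'l : n' < ℓ) :
    ¬ ∃ i : ℕ, Odd i ∧ 0 < i ∧ i + 1 ≤ 2 * ℓ ∧
      ({pairAt (Xword n' ℓ) i, pairAt (Yword n ℓ) i, pairAt (Zword n ℓ) i} :
          Set (Fin 2 × Fin 2)) =
        {((0 : Fin 2), (0 : Fin 2)), (0, 1), (1, 0)} := by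
  rintro ⟨i, ⟨k, rfl⟩, -, -, h⟩
  unfold Xword Yword Zword at h
  rw [pairAt_blocks, pairAt_blocks, pairAt_blocks] at h
  have h1 := (Set.ext_iff.mp h (0, 0)).mpr (by simp)
  have h2 := (Set.ext_iff.mp h (0, 1)).mpr (by simp)
  have h3 := (Set.ext_iff.mp h (1, 0)).mpr (by simp)
  clear h
  simp only [Set.mem_insert_iff, Set.mem_singleton_iff] at h1 h2 h3
  rcases lt_trichotomy k n with hk | hk | hk
  · by_cases hk' : k = n'
    · subst hk'
      simp [hk] at h1
    · simp [hk, hk'] at h2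
  · subst hk
    simp [hne] at h2
  · simp [hk.not_gt, hk.ne'] at h3
    split_ifs at h3 <;> simp at h3
end

section
/- Fix sets of binary words A^1, A^2, A^3, A^4, A^5 ⊆ {0,1}* and let S¹ = {(a₁a₂, a₁a₃a₄, a₁a₃a₅) : a₁ ∈ A^1, a₂ ∈ A^2, a₃ ∈ A^3, a₄ ∈ A^4, a₅ ∈ A^5}. Suppose (X, Y, Z) ∈ S¹ and (X', Y', Z') ∈ S¹ are triples such that X and Y are both nonempty and differ in their first symbol, and X' and Y' are both nonempty and differ in their first symbol. Then (X', Y, Z) ∈ S¹. -/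
/-- If `(X, Y, Z)` and `(X', Y', Z')` both lie in the special relation `S¹`, and in
each triple the first two components are nonempty and differ in their first symbol,
then the mixed triple `(X', Y, Z)` also lies in `S¹`. -/
theorem specRel1_mix (A : Fin 5 → Set (List (Fin 2)))
    (X Y Z X' Y' Z' : List (Fin 2))
    (h : SpecRel1 A X Y Z) (h' : SpecRel1 A X' Y' Z')
    (hX : X ≠ []) (hY : Y ≠ []) (hXY : X.getD 0 0 ≠ Y.getD 0 0)
    (hX' : X' ≠ []) (hY' : Y' ≠ []) (hXY' : X'.getD 0 0 ≠ Y'.getD 0 0) :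
    SpecRel1 A X' Y Z := by
  obtain ⟨a, ha, b, hb, c, hc, d, hd, e, he, rfl, rfl, rfl⟩ := h
  obtain ⟨a', ha', b', hb', c', hc', d', hd', e', he', rfl, rfl, rfl⟩ := h'
  cases a with
  | cons x t => simp at hXY
  | nil =>
    cases a' with
    | cons x t => simp at hXY'
    | nil => exact ⟨[], ha, b', hb', c, hc, d, hd, e, he, rfl, rfl, rfl⟩
end

section
/- Fix sets of binary words A^1, A^2, A^3, A^4, A^5 ⊆ {0,1}* and let S² = {(a₁a₃a₄, a₁a₂, a₁a₃a₅) : a₁ ∈ A^1, a₂ ∈ A^2, a₃ ∈ A^3, a₄ ∈ A^4, a₅ ∈ A^5}. Suppose (X, Y, Z) ∈ S² and (X', Y', Z') ∈ S² are triples such that in each triple the first component is nonempty and differs in its first symbol from the second component and also differs in its first symbol from the third component (all components nonempty). Then (X', Y, Z) ∈ S². -/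
/-- If `(X, Y, Z)` and `(X', Y', Z')` both lie in the special relation `S²`, and in
each triple all components are nonempty, the first component differing in its first
symbol from the second and from the third, then the mixed triple `(X', Y, Z)` also
lies in `S²`. -/
theorem specRel2_mix (A : Fin 5 → Set (List (Fin 2)))
    (X Y Z X' Y' Z' : List (Fin 2))
    (h : SpecRel2 A X Y Z) (h' : SpecRel2 A X' Y' Z')
    (hX : X ≠ []) (hY : Y ≠ []) (hZ : Z ≠ [])
    (hXY : X.getD 0 0 ≠ Y.getD 0 0) (hXZ : X.getD 0 0 ≠ Z.getD 0 0)
    (hX' : X' ≠ []) (hY' : Y' ≠ []) (hZ' : Z' ≠ [])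
    (hXY' : X'.getD 0 0 ≠ Y'.getD 0 0) (hXZ' : X'.getD 0 0 ≠ Z'.getD 0 0) :
    SpecRel2 A X' Y Z := by
  obtain ⟨a₁, h₁, a₂, h₂, a₃, h₃, a₄, h₄, a₅, h₅, rfl, rfl, rfl⟩ := h
  obtain ⟨b₁, k₁, b₂, k₂, b₃, k₃, b₄, k₄, b₅, k₅, rfl, rfl, rfl⟩ := h'
  have e₁ : a₁ = [] := by
    cases a₁ with
    | nil => rfl
    | cons x l => simp at hXY
  have f₁ : b₁ = [] := by
    cases b₁ with
    | nil => rfl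
    | cons x l => simp at hXY'
  subst e₁ f₁
  have e₃ : a₃ = [] := by
    cases a₃ with
    | nil => rfl
    | cons x l => simp at hXZ
  have f₃ : b₃ = [] := by
    cases b₃ with
    | nil => rfl
    | cons x l => simp at hXZ'
  subst e₃ f₃
  exact ⟨[], h₁, a₂, h₂, [], h₃, b₄, k₄, a₅, h₅, rfl, rfl, rfl⟩
end

section
/- There is no trifferent code of size 11 and length 5 over the ternary alphabet; equivalently, every set C ⊆ {0,1,2}^5 with the property that any three pairwise distinct elements x, y, z of C admit a coordinate i ∈ {1,…,5} at which x_i, y_i, z_i are pairwise distinct, satisfies |C| ≤ 10. -/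
namespace Triff

/-- Words over the ternary alphabet. -/
abbrev Wd := List (Fin 3)

/-- The letters in constructor form (so that the kernel does not unfold numeral instances). -/
def a0 : Fin 3 := ⟨0, by decide⟩
def a1 : Fin 3 := ⟨1, by decide⟩
def a2 : Fin 3 := ⟨2, by decide⟩

def rb (a b c : Fin 3) : Bool :=
  cond (Nat.beq a.1 b.1) false (cond (Nat.beq a.1 c.1) false (cond (Nat.beq b.1 c.1) false true))

/-- `triff x y z`: some coordinate separates the three words. Written with recursors so that
it evaluates quickly in the kernel. -/
noncomputable def triff (x : Wd) : Wd → Wd → Bool :=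
  List.rec (fun _ _ => false)
    (fun a _ ih y z => List.rec false
      (fun b y' _ => List.rec false
        (fun c z' _ => cond (rb a b c) true (ih y' z')) z) y) x

lemma triff_nil1 (y z : Wd) : triff [] y z = false := rfl
lemma triff_nil2 (a : Fin 3) (x z : Wd) : triff (a :: x) [] z = false := rfl
lemma triff_nil3 (a b : Fin 3) (x y : Wd) : triff (a :: x) (b :: y) [] = false := rfl
lemma triff_cons (a b c : Fin 3) (x y z : Wd) :
    triff (a :: x) (b :: y) (c :: z) = (rb a b c || triff x y z) := by
  change cond (rb a b c) true (triff x y z) = _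
  cases rb a b c <;> rfl

/-- Letterwise action. -/
def act (σ : List (Fin 3 → Fin 3)) (x : Wd) : Wd := List.zipWith (fun f a => f a) σ x

def allW : ℕ → List Wd
  | 0 => [[]]
  | n + 1 => (allW n).flatMap fun w => [a0 :: w, a1 :: w, a2 :: w]

/-- `w` separates `x` from all words of `P`. -/
noncomputable def okx (w x : Wd) (P : List Wd) : Bool :=
  List.rec true (fun y _ ih => cond (triff w x y) ih false) P

noncomputable def ok (w : Wd) (P : List Wd) : Bool :=
  List.rec true (fun x P ih => cond (okx w x P) ih false) P

lemma okx_eq (w x : Wd) (P : List Wd) : okx w x P = P.all (triff w x) := by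
  induction P with
  | nil => rfl
  | cons y P ih =>
    change cond (triff w x y) (okx w x P) false = _
    rw [ih, List.all_cons]
    cases triff w x y <;> rfl

lemma ok_cons (w x : Wd) (P : List Wd) : ok w (x :: P) = (P.all (triff w x) && ok w P) := by
  change cond (okx w x P) (ok w P) false = _
  rw [okx_eq]
  cases P.all (triff w x) <;> rfl

noncomputable def colr : List Wd → List Wd → List (List Wd)
  | [], P => [P]
  | x :: r, P =>
    (cond (ok (a0 :: x) P) (colr r ((a0 :: x) :: P)) []) ++
    (cond (ok (a1 :: x) P) (colr r ((a1 :: x) :: P)) [])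

lemma colr_cons (x : Wd) (r P : List Wd) : colr (x :: r) P =
    (cond (ok (0 :: x) P) (colr r ((0 :: x) :: P)) []) ++
    (cond (ok (1 :: x) P) (colr r ((1 :: x) :: P)) []) := rfl

noncomputable def start : List Wd → List Wd → List (List Wd)
  | [], P => [P]
  | x :: r, P => cond (ok (a0 :: x) P) (colr r ((a0 :: x) :: P)) []

lemma start_cons (x : Wd) (r P : List Wd) :
    start (x :: r) P = cond (ok (0 :: x) P) (colr r ((0 :: x) :: P)) [] := rfl

noncomputable def addW (Ws : List Wd) : ℕ → List Wd → List (List Wd)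
  | 0, P => [P]
  | k + 1, P => Ws.flatMap fun w => cond (ok w P) (addW Ws k (w :: P)) []

noncomputable def ext (n k : ℕ) (r : List Wd) : List (List Wd) :=
  ((allW n).map (fun w => a2 :: w)).flatMap fun w =>
    (start r [w]).flatMap (addW ((allW n).map (fun w => a2 :: w)) k)

lemma ext_eq (n k : ℕ) (r : List Wd) : ext n k r =
  ((allW n).map (fun w => 2 :: w)).flatMap fun w =>
    (start r [w]).flatMap (addW ((allW n).map (fun w => 2 :: w)) k) := rfl

/-! ### Codes -/

structure Code (n : ℕ) (C : Finset Wd) : Prop where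
  len : ∀ x ∈ C, x.length = n
  tri : ∀ x ∈ C, ∀ y ∈ C, ∀ z ∈ C, x ≠ y → x ≠ z → y ≠ z → triff x y z = true

structure Good (n : ℕ) (σ : List (Fin 3 → Fin 3)) (C : Finset Wd) (P : List Wd) : Prop where
  len : σ.length = n
  surj : ∀ f ∈ σ, Function.Surjective f
  nodup : (P.map (act σ)).Nodup
  mem : ∀ x ∈ P, act σ x ∈ C

def Cov (n m : ℕ) (L : List (List Wd)) : Prop :=
  ∀ C, Code n C → m ≤ C.card → ∃ σ, ∃ r ∈ L, Good n σ C r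

def Bnd (n M : ℕ) : Prop := ∀ C, Code n C → C.card ≤ M

lemma rb_iff (a b c : Fin 3) : rb a b c = true ↔ a ≠ b ∧ a ≠ c ∧ b ≠ c := by
  revert a b c; decide

lemma triff_of_act (σ : List (Fin 3 → Fin 3)) : ∀ x y z : Wd,
    triff (act σ x) (act σ y) (act σ z) = true → triff x y z = true := by
  induction σ with
  | nil => intro x y z h; simp [act, triff_nil1, triff_nil2, triff_nil3] at h
  | cons f σ ih =>
    intro x y z h
    rcases x with _ | ⟨a, x⟩
    · simp [act, triff_nil1, triff_nil2, triff_nil3] at h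
    rcases y with _ | ⟨b, y⟩
    · simp [act, triff_nil1, triff_nil2, triff_nil3] at h
    rcases z with _ | ⟨c, z⟩
    · simp [act, triff_nil1, triff_nil2, triff_nil3] at h
    simp only [act, List.zipWith_cons_cons, triff_cons, Bool.or_eq_true, rb_iff] at h ⊢
    rcases h with ⟨h1, h2, h3⟩ | h
    · left
      exact ⟨fun e => h1 (by rw [e]), fun e => h2 (by rw [e]), fun e => h3 (by rw [e])⟩
    · right; exact ih x y z h

lemma ok_of_good {n σ C w P} (hC : Code n C) (h : Good n σ C (w :: P)) : ok w P = true := by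
  induction P with
  | nil => rfl
  | cons x P ih =>
    have hn := h.nodup
    simp only [List.map_cons, List.nodup_cons, List.mem_cons, List.mem_map, not_or,
      not_exists, not_and] at hn
    obtain ⟨⟨h1, h2⟩, h3, h4⟩ := hn
    simp only [ok_cons, Bool.and_eq_true, List.all_eq_true]
    refine ⟨fun y hy => ?_, ih ⟨h.len, h.surj, ?_, ?_⟩⟩
    · apply triff_of_act σ
      exact hC.tri _ (h.mem _ (by simp)) _ (h.mem _ (by simp)) _ (h.mem _ (by simp [hy]))
        h1 (fun e => h2 y hy e.symm) (fun e => h3 y hy e.symm)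
    · simp only [List.map_cons, List.nodup_cons, List.mem_map, not_exists, not_and]
      exact ⟨h2, h4⟩
    · intro y hy
      apply h.mem
      simp only [List.mem_cons] at hy ⊢
      tauto

lemma Good.cons {n σ C w P} (h : Good n σ C P) (h1 : act σ w ∈ C)
    (h2 : ∀ p ∈ P, act σ p ≠ act σ w) : Good n σ C (w :: P) := by
  refine ⟨h.len, h.surj, ?_, ?_⟩
  · simp only [List.map_cons, List.nodup_cons, List.mem_map, not_exists, not_and]
    exact ⟨h2, h.nodup⟩
  · intro y hy
    rcases List.mem_cons.1 hy with rfl | hy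
    · exact h1
    · exact h.mem y hy

lemma addW_good {n σ C} (hC : Code n C) (Ws : List Wd) : ∀ (us : List Wd) (P : List Wd),
    Good n σ C P → us.Nodup → (∀ u ∈ us, u ∈ C ∧ ∃ w ∈ Ws, act σ w = u) →
    (∀ p ∈ P, act σ p ∉ us) →
    ∃ P' ∈ addW Ws us.length P, Good n σ C P' := by
  intro us
  induction us with
  | nil => intro P h _ _ _; exact ⟨P, by simp [addW], h⟩
  | cons u us ih =>
    intro P h hn hu hd
    obtain ⟨huC, w, hw, rfl⟩ := hu u (by simp)
    have hg : Good n σ C (w :: P) := h.cons huC (fun p hp e => hd p hp (by simp [e]))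
    obtain ⟨P', hP', hg'⟩ := ih (w :: P) hg (List.nodup_cons.1 hn).2
      (fun u hu' => hu u (by simp [hu'])) (by
        intro p hp
        rcases List.mem_cons.1 hp with rfl | hp
        · exact (List.nodup_cons.1 hn).1
        · exact fun e => hd p hp (by simp [e]))
    refine ⟨P', ?_, hg'⟩
    simp only [List.length_cons, addW, List.mem_flatMap]
    refine ⟨w, hw, ?_⟩
    rw [ok_of_good hC hg]
    exact hP'

lemma colr_good {n τ σ C} (hC : Code n C) : ∀ (r P : List Wd),
    Good n (τ :: σ) C P → (r.map (act σ)).Nodup →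
    (∀ x ∈ r, act (τ :: σ) (0 :: x) ∈ C ∨ act (τ :: σ) (1 :: x) ∈ C) →
    (∀ p ∈ P, ∀ x ∈ r, ∀ c, c ≠ 2 → act (τ :: σ) p ≠ act (τ :: σ) (c :: x)) →
    ∃ P' ∈ colr r P, Good n (τ :: σ) C P' ∧
      ∀ p ∈ P', p ∈ P ∨ ∃ c x, c ≠ 2 ∧ p = c :: x := by
  intro r
  induction r with
  | nil => intro P h _ _ _; exact ⟨P, by simp [colr], h, fun p hp => Or.inl hp⟩
  | cons x r ih =>
    intro P h hn hc hd
    have key : ∀ c : Fin 3, c ≠ 2 → act (τ :: σ) (c :: x) ∈ C →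
        ok (c :: x) P = true ∧ ∃ P' ∈ colr r ((c :: x) :: P), Good n (τ :: σ) C P' ∧
          ∀ p ∈ P', p ∈ P ∨ ∃ c x, c ≠ 2 ∧ p = c :: x := by
      intro c hc2 hcC
      have hg : Good n (τ :: σ) C ((c :: x) :: P) :=
        h.cons hcC (fun p hp => hd p hp x (by simp) c hc2)
      refine ⟨ok_of_good hC hg, ?_⟩
      obtain ⟨P', h1, h2, h3⟩ := ih ((c :: x) :: P) hg (List.nodup_cons.1 hn).2
        (fun y hy => hc y (by simp [hy])) (by
          intro p hp y hy d hd2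
          rcases List.mem_cons.1 hp with rfl | hp
          · intro e
            simp only [act, List.zipWith_cons_cons, List.cons.injEq] at e
            apply (List.nodup_cons.1 hn).1
            rw [List.mem_map]
            exact ⟨y, hy, e.2.symm⟩
          · exact hd p hp y (by simp [hy]) d hd2)
      refine ⟨P', h1, h2, fun p hp => ?_⟩
      rcases h3 p hp with h4 | h4
      · rcases List.mem_cons.1 h4 with rfl | h5
        · exact Or.inr ⟨c, x, hc2, rfl⟩
        · exact Or.inl h5
      · exact Or.inr h4
    rcases hc x (by simp) with h0 | h0
    · obtain ⟨hk, P', h1, h2⟩ := key 0 (by decide) h0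
      refine ⟨P', ?_, h2⟩
      simp only [colr_cons, hk, cond_true, List.mem_append]
      exact Or.inl h1
    · obtain ⟨hk, P', h1, h2⟩ := key 1 (by decide) h0
      refine ⟨P', ?_, h2⟩
      simp only [colr_cons, hk, cond_true, List.mem_append]
      exact Or.inr h1

lemma start_good {n τ σ C} (hC : Code n C) (r P : List Wd)
    (h : Good n (τ :: σ) C P) (hn : (r.map (act σ)).Nodup)
    (hc : ∀ x ∈ r, act (τ :: σ) (0 :: x) ∈ C ∨ act (τ :: σ) (1 :: x) ∈ C)
    (h0 : ∀ x ∈ r.head?, act (τ :: σ) (0 :: x) ∈ C)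
    (hd : ∀ p ∈ P, ∀ x ∈ r, ∀ c, c ≠ 2 → act (τ :: σ) p ≠ act (τ :: σ) (c :: x)) :
    ∃ P' ∈ start r P, Good n (τ :: σ) C P' ∧
      ∀ p ∈ P', p ∈ P ∨ ∃ c x, c ≠ 2 ∧ p = c :: x := by
  rcases r with _ | ⟨x, r⟩
  · exact ⟨P, by simp [start], h, fun p hp => Or.inl hp⟩
  · have hcC := h0 x (by simp)
    have hg : Good n (τ :: σ) C ((0 :: x) :: P) :=
      h.cons hcC (fun p hp => hd p hp x (by simp) 0 (by decide))
    obtain ⟨P', h1, h2, h3⟩ := colr_good hC r ((0 :: x) :: P) hg (List.nodup_cons.1 hn).2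
      (fun y hy => hc y (by simp [hy])) (by
        intro p hp y hy d hd2
        rcases List.mem_cons.1 hp with rfl | hp
        · intro e
          simp only [act, List.zipWith_cons_cons, List.cons.injEq] at e
          apply (List.nodup_cons.1 hn).1
          rw [List.mem_map]
          exact ⟨y, hy, e.2.symm⟩
        · exact hd p hp y (by simp [hy]) d hd2)
    refine ⟨P', ?_, h2, fun p hp => ?_⟩
    · simp only [start_cons, ok_of_good hC hg, cond_true]
      exact h1
    · rcases h3 p hp with h4 | h4
      · rcases List.mem_cons.1 h4 with rfl | h5
        · exact Or.inr ⟨0, x, by decide, rfl⟩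
        · exact Or.inl h5
      · exact Or.inr h4

lemma mem_allW : ∀ (n : ℕ) (w : Wd), w.length = n → w ∈ allW n := by
  intro n
  induction n with
  | zero => intro w h; rw [List.length_eq_zero_iff] at h; simp [h, allW]
  | succ n ih =>
    intro w h
    rcases w with _ | ⟨a, w⟩
    · simp at h
    · simp only [allW, List.mem_flatMap]
      refine ⟨w, ih w (by simpa using h), ?_⟩
      have : a = 0 ∨ a = 1 ∨ a = 2 := by clear h; revert a; decide
      rcases this with rfl | rfl | rfl <;> simp [a0, a1, a2]

lemma act_surj (σ : List (Fin 3 → Fin 3)) (hs : ∀ f ∈ σ, Function.Surjective f) :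
    ∀ u : Wd, u.length = σ.length → ∃ w : Wd, w.length = σ.length ∧ act σ w = u := by
  induction σ with
  | nil => intro u hu; exact ⟨[], rfl, by simp at hu; simp [hu, act]⟩
  | cons f σ ih =>
    intro u hu
    rcases u with _ | ⟨a, u⟩
    · simp at hu
    obtain ⟨w, h1, h2⟩ := ih (fun g hg => hs g (by simp [hg])) u (by simpa using hu)
    obtain ⟨b, hb⟩ := hs f (by simp) a
    refine ⟨b :: w, by simp [h1], ?_⟩
    simp only [act, List.zipWith_cons_cons, hb] at h2 ⊢
    rw [h2]

lemma exists_tau : ∀ s c : Fin 3, c ≠ s → ∃ τ : Fin 3 → Fin 3,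
    Function.Bijective τ ∧ τ 2 = s ∧ τ 0 = c := by
  intro s c h
  have : ∃ d : Fin 3, d ≠ s ∧ d ≠ c := by revert s c; decide
  obtain ⟨d, hd, hd'⟩ := this
  have hi : Function.Injective ![c, d, s] := by
    intro i j
    fin_cases i <;> fin_cases j <;> simp [h, hd, hd', Ne.symm h, Ne.symm hd, Ne.symm hd']
  exact ⟨![c, d, s], ⟨hi, Finite.surjective_of_injective hi⟩, rfl, rfl⟩

def Dl (C : Finset Wd) (s : Fin 3) : Finset Wd := C.filter (fun x => x.head? ≠ some s)
def Ul (C : Finset Wd) (s : Fin 3) : Finset Wd := C.filter (fun x => x.head? = some s)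

lemma ext_good {n k σ C s r} (hC : Code (n + 1) C)
    (hr : Good n σ ((Dl C s).image List.tail) r)
    (hk : k + 1 ≤ (Ul C s).card) : ∃ σ', ∃ P ∈ ext n k r, Good (n + 1) σ' C P := by
  have hcol : ∀ x ∈ r, ∃ c, c ≠ s ∧ c :: act σ x ∈ C := by
    intro x hx
    have := hr.mem x hx
    rw [Finset.mem_image] at this
    obtain ⟨y, hy, hyx⟩ := this
    rw [Dl, Finset.mem_filter] at hy
    rcases y with _ | ⟨c, y⟩
    · have := hC.len _ hy.1; simp at this
    · refine ⟨c, by simpa using hy.2, ?_⟩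
      simp only [List.tail_cons] at hyx
      rw [← hyx]; exact hy.1
  obtain ⟨c0, hc0, hc0'⟩ : ∃ c, c ≠ s ∧ ∀ x ∈ r.head?, c :: act σ x ∈ C := by
    rcases r with _ | ⟨x, r⟩
    · have : ∃ d : Fin 3, d ≠ s := exists_ne s
      obtain ⟨d, hd⟩ := this
      exact ⟨d, hd, by simp⟩
    · obtain ⟨c, h1, h2⟩ := hcol x (by simp)
      exact ⟨c, h1, by simpa using h2⟩
  obtain ⟨τ, hτ, hτ2, hτ0⟩ := exists_tau s c0 hc0
  have hact : ∀ c x, act (τ :: σ) (c :: x) = τ c :: act σ x := fun c x => by simp [act]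
  have hne : ∀ c, c ≠ 2 → τ c ≠ s := fun c hc e => hc (hτ.1 (by rw [e, hτ2]))
  obtain ⟨T, hTU, hTc⟩ := Finset.exists_subset_card_eq hk
  have hW : ∀ u ∈ T, u ∈ C ∧ u.head? = some s ∧
      ∃ w ∈ (allW n).map (fun w => 2 :: w), act (τ :: σ) w = u := by
    intro u hu
    have hu := hTU hu
    rw [Ul, Finset.mem_filter] at hu
    refine ⟨hu.1, hu.2, ?_⟩
    have hl := hC.len u hu.1
    rcases u with _ | ⟨a, u⟩
    · simp at hl
    have ha : a = s := by simpa using hu.2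
    obtain ⟨w, hw1, hw2⟩ := act_surj σ hr.surj u (by rw [hr.len]; simpa using hl)
    refine ⟨2 :: w, ?_, ?_⟩
    · rw [List.mem_map]
      exact ⟨w, mem_allW n w (by rw [hw1, hr.len]), rfl⟩
    · rw [hact, hτ2, hw2, ha]
  have hlen : T.toList.length = k + 1 := by rw [Finset.length_toList, hTc]
  have hnd := T.nodup_toList
  have hmt : ∀ u ∈ T.toList, u ∈ T := fun u hu => Finset.mem_toList.1 hu
  generalize T.toList = us at hlen hnd hmt
  rcases us with _ | ⟨u, us⟩
  · simp at hlen
  obtain ⟨huC, hus, w, hw, hwu⟩ := hW u (hmt u (by simp))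
  have hg0 : Good (n + 1) (τ :: σ) C [w] := by
    refine ⟨by simp [hr.len], ?_, by simp, ?_⟩
    · intro f hf
      rcases List.mem_cons.1 hf with rfl | hf
      · exact hτ.2
      · exact hr.surj f hf
    · intro x hx
      rw [List.mem_singleton] at hx
      rw [hx, hwu]; exact huC
  obtain ⟨P1, hP1, hg1, hP1'⟩ := start_good hC r [w] hg0 hr.nodup (by
      intro x hx
      obtain ⟨c, h1, h2⟩ := hcol x hx
      obtain ⟨d, hd⟩ := hτ.2 c
      have hd2 : d ≠ 2 := by rintro rfl; exact h1 (by rw [← hd, hτ2])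
      have : d = 0 ∨ d = 1 := by clear hd; revert d; decide
      rw [hact, hact]
      rcases this with rfl | rfl
      · left; rw [hd]; exact h2
      · right; rw [hd]; exact h2) (by
      intro x hx
      rw [hact, hτ0]; exact hc0' x hx) (by
      intro p hp x hx c hc e
      rw [List.mem_singleton] at hp
      rw [hp, hwu, hact] at e
      rw [e] at hus
      exact hne c hc (by simpa using hus))
  obtain ⟨P2, hP2, hg2⟩ := addW_good hC ((allW n).map (fun w => 2 :: w)) us P1 hg1
    (List.nodup_cons.1 hnd).2
    (fun v hv => ⟨(hW v (hmt v (by simp [hv]))).1, (hW v (hmt v (by simp [hv]))).2.2⟩) (by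
      intro p hp hpu
      rcases hP1' p hp with h | ⟨c, x, hc, rfl⟩
      · rw [List.mem_singleton] at h
        rw [h, hwu] at hpu
        exact (List.nodup_cons.1 hnd).1 hpu
      · have := (hW _ (hmt _ (List.mem_cons_of_mem _ hpu))).2.1
        rw [hact] at this
        exact hne c hc (by simpa using this))
  have : us.length = k := by simpa using hlen
  rw [this] at hP2
  refine ⟨τ :: σ, P2, ?_, hg2⟩
  simp only [ext_eq, List.mem_flatMap]
  exact ⟨w, hw, P1, hP1, hP2⟩

lemma card_split (C : Finset Wd) (s : Fin 3) : (Ul C s).card + (Dl C s).card = C.card := by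
  exact Finset.card_filter_add_card_filter_not _

lemma rb_false {a b c s : Fin 3} (ha : a ≠ s) (hb : b ≠ s) (hc : c ≠ s) : rb a b c = false := by
  revert a b c s; decide

lemma triff_self : ∀ x z : Wd, triff x x z = false := by
  intro x
  induction x with
  | nil => intro z; rfl
  | cons a x ih =>
    intro z
    rcases z with _ | ⟨c, z⟩
    · rfl
    · simp only [triff_cons, ih, Bool.or_false]
      revert a c; decide

lemma Dl_tri {n C s} (hC : Code (n + 1) C) : ∀ x ∈ Dl C s, ∀ y ∈ Dl C s, ∀ z ∈ Dl C s,
    x ≠ y → x ≠ z → y ≠ z → triff x.tail y.tail z.tail = true := by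
  intro x hx y hy z hz h1 h2 h3
  rw [Dl, Finset.mem_filter] at hx hy hz
  have ht := hC.tri x hx.1 y hy.1 z hz.1 h1 h2 h3
  rcases x with _ | ⟨a, x⟩
  · simp [triff_nil1, triff_nil2, triff_nil3] at ht
  rcases y with _ | ⟨b, y⟩
  · simp [triff_nil1, triff_nil2, triff_nil3] at ht
  rcases z with _ | ⟨c, z⟩
  · simp [triff_nil1, triff_nil2, triff_nil3] at ht
  simp only [triff_cons, rb_false (s := s) (by simpa using hx.2) (by simpa using hy.2)
    (by simpa using hz.2), Bool.false_or] at ht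
  exact ht

lemma Dl_code {n C} (s : Fin 3) (hC : Code (n + 1) C) : Code n ((Dl C s).image List.tail) := by
  constructor
  · intro x hx
    rw [Finset.mem_image] at hx
    obtain ⟨y, hy, rfl⟩ := hx
    rw [Dl, Finset.mem_filter] at hy
    rw [List.length_tail, hC.len y hy.1]; rfl
  · intro x hx y hy z hz h1 h2 h3
    rw [Finset.mem_image] at hx hy hz
    obtain ⟨x, hx, rfl⟩ := hx
    obtain ⟨y, hy, rfl⟩ := hy
    obtain ⟨z, hz, rfl⟩ := hz
    exact Dl_tri hC x hx y hy z hz (fun e => h1 (by rw [e])) (fun e => h2 (by rw [e]))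
      (fun e => h3 (by rw [e]))

lemma Dl_card {n C} (s : Fin 3) (hC : Code (n + 1) C) (h : 3 ≤ (Dl C s).card) :
    ((Dl C s).image List.tail).card = (Dl C s).card := by
  apply Finset.card_image_of_injOn
  intro x hx y hy hxy
  by_contra hne
  obtain ⟨z, hz, hzn⟩ : ∃ z ∈ Dl C s, z ∉ ({x, y} : Finset Wd) := by
    apply Finset.exists_mem_notMem_of_card_lt_card
    exact lt_of_le_of_lt Finset.card_le_two (by omega)
  simp only [Finset.mem_insert, Finset.mem_singleton, not_or] at hzn
  have := Dl_tri hC x hx y hy z hz hne (Ne.symm hzn.1) (Ne.symm hzn.2)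
  rw [hxy, triff_self] at this
  exact Bool.false_ne_true this

lemma Dl_le {n M C} (s : Fin 3) (hB : Bnd n M) (hM : 2 ≤ M) (hC : Code (n + 1) C) :
    (Dl C s).card ≤ M := by
  by_cases h : 3 ≤ (Dl C s).card
  · rw [← Dl_card s hC h]; exact hB _ (Dl_code s hC)
  · omega

lemma Ul_sum {n C} (hC : Code (n + 1) C) :
    (Ul C 0).card + (Ul C 1).card + (Ul C 2).card = C.card := by
  have h := Finset.card_eq_sum_card_fiberwise (s := C) (t := Finset.univ)
    (f := fun x : Wd => x.head?.getD 0) (by intro x _; simp)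
  rw [Fin.sum_univ_three] at h
  rw [h]
  have key : ∀ s : Fin 3, Ul C s = C.filter (fun x => x.head?.getD 0 = s) := by
    intro s
    apply Finset.filter_congr
    intro x hx
    rcases x with _ | ⟨a, x⟩
    · have := hC.len _ hx; simp at this
    · simp
  rw [key, key, key]

lemma Bnd_succ {n M M'} (hB : Bnd n M) (hM : 2 ≤ M) (h : 3 * M < 2 * (M' + 1)) :
    Bnd (n + 1) M' := by
  intro C hC
  have h0 := Dl_le 0 hB hM hC
  have h1 := Dl_le 1 hB hM hC
  have h2 := Dl_le 2 hB hM hC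
  have s0 := card_split C 0
  have s1 := card_split C 1
  have s2 := card_split C 2
  have := Ul_sum hC
  omega

lemma exists_sym {n C} (hC : Code (n + 1) C) : ∃ s, 3 * (Ul C s).card ≤ C.card := by
  by_contra hcon
  push Not at hcon
  have h0 := hcon 0
  have h1 := hcon 1
  have h2 := hcon 2
  have := Ul_sum hC
  omega

lemma Cov_succ {n M m N k L L'} (hB : Bnd n M) (hM : 2 ≤ M) (hL : Cov n m L) (hm : 3 ≤ m)
    (hN : ∀ c d, c + d = N → 3 * c ≤ N → d ≤ M → m ≤ d ∧ k + 1 ≤ c)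
    (hL' : ∀ r ∈ L, ∀ P ∈ ext n k r, P ∈ L') : Cov (n + 1) N L' := by
  intro C hC hc
  obtain ⟨C', hsub, hcard⟩ := Finset.exists_subset_card_eq hc
  have hC' : Code (n + 1) C' := ⟨fun x hx => hC.len x (hsub hx), fun x hx y hy z hz =>
    hC.tri x (hsub hx) y (hsub hy) z (hsub hz)⟩
  obtain ⟨s, hs⟩ := exists_sym hC'
  have hd := Dl_le s hB hM hC'
  have hsp := card_split C' s
  obtain ⟨h1, h2⟩ := hN _ _ (hsp.trans hcard) (by omega) hd
  obtain ⟨σ, r, hr, hg⟩ := hL _ (Dl_code s hC') (by rw [Dl_card s hC' (by omega)]; exact h1)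
  obtain ⟨σ', P, hP, hg'⟩ := ext_good hC' hg h2
  exact ⟨σ', P, hL' r hr P hP, hg'.len, hg'.surj, hg'.nodup, fun x hx => hsub (hg'.mem x hx)⟩

/-! ### Reduction up to equivalence -/

def pm : ℕ → Fin 3 → Fin 3
  | 0 => ![0, 1, 2]
  | 1 => ![0, 2, 1]
  | 2 => ![1, 0, 2]
  | 3 => ![1, 2, 0]
  | 4 => ![2, 0, 1]
  | _ => ![2, 1, 0]

lemma pm_surj (i : ℕ) : Function.Surjective (pm i) := by
  unfold pm
  split <;> decide

def redOK (n : ℕ) (r : List Wd) (q : List ℕ × List Wd) : Bool :=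
  q.1.length == n && (decide ((q.2.map (act (q.1.map pm))).Nodup) &&
    q.2.all (fun x => r.contains (act (q.1.map pm) x)))

lemma act_act (σ ρ : List (Fin 3 → Fin 3)) (x : Wd) :
    act σ (act ρ x) = act (List.zipWith (fun f g => f ∘ g) σ ρ) x := by
  induction σ generalizing ρ x with
  | nil => simp [act]
  | cons f σ ih =>
    rcases ρ with _ | ⟨g, ρ⟩
    · simp [act]
    rcases x with _ | ⟨a, x⟩
    · simp [act]
    have := ih ρ x
    simp only [act, List.zipWith_cons_cons, Function.comp] at this ⊢
    rw [this]

lemma Cov_red {n m L} (hL : Cov n m L) (K : List (List Wd)) (wit : List (List ℕ × List Wd))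
    (hK : wit.all (fun q => K.contains q.2) = true)
    (h : L.all (fun r => wit.any (redOK n r)) = true) : Cov n m K := by
  intro C hC hc
  obtain ⟨σ, r, hr, hg⟩ := hL C hC hc
  rw [List.all_eq_true] at h hK
  have h1 := h r hr
  rw [List.any_eq_true] at h1
  obtain ⟨q, hq, hq'⟩ := h1
  simp only [redOK, Bool.and_eq_true, beq_iff_eq, decide_eq_true_eq, List.all_eq_true,
    List.contains_iff_mem] at hq'
  obtain ⟨hl, hnd, hmem⟩ := hq'
  refine ⟨List.zipWith (fun f g => f ∘ g) σ (q.1.map pm), q.2,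
    by simpa using hK q hq, ?_, ?_, ?_, ?_⟩
  · simp [hg.len, hl]
  · intro f hf
    rw [List.mem_iff_getElem] at hf
    obtain ⟨i, hi, rfl⟩ := hf
    rw [List.getElem_zipWith]
    apply Function.Surjective.comp
    · exact hg.surj _ (List.getElem_mem _)
    · rw [List.getElem_map]; exact pm_surj _
  · have : q.2.map (act (List.zipWith (fun f g => f ∘ g) σ (q.1.map pm))) =
        (q.2.map (act (q.1.map pm))).map (act σ) := by
      rw [List.map_map]
      apply List.map_congr_left
      intro x _
      rw [Function.comp, act_act]
    rw [this]
    apply List.Nodup.map_on _ hnd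
    intro x hx y hy hxy
    rw [List.mem_map] at hx hy
    obtain ⟨x, hx, rfl⟩ := hx
    obtain ⟨y, hy, rfl⟩ := hy
    exact List.inj_on_of_nodup_map hg.nodup (hmem x hx) (hmem y hy) hxy
  · intro x hx
    rw [← act_act]
    exact hg.mem _ (hmem x hx)

/-! ### The chain -/

lemma code_one {C} (hC : Code 1 C) : C ⊆ {[0], [1], [2]} := by
  intro x hx
  have := hC.len x hx
  rw [List.length_eq_one_iff] at this
  obtain ⟨a, rfl⟩ := this
  clear hx
  revert a; decide

lemma Bnd1 : Bnd 1 3 := fun _ hC => (Finset.card_le_card (code_one hC)).trans (by decide)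
lemma Bnd2 : Bnd 2 4 := Bnd_succ Bnd1 (by norm_num) (by norm_num)
lemma Bnd3 : Bnd 3 6 := Bnd_succ Bnd2 (by norm_num) (by norm_num)
lemma Bnd4 : Bnd 4 9 := Bnd_succ Bnd3 (by norm_num) (by norm_num)

lemma Cov1 : Cov 1 3 [[[0], [1], [2]]] := by
  intro C hC hc
  have hE : C = {[0], [1], [2]} :=
    Finset.eq_of_subset_of_card_le (code_one hC) (le_trans (by decide) hc)
  refine ⟨[id], _, List.mem_singleton.2 rfl, rfl, ?_, by decide, ?_⟩
  · intro f hf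
    rw [List.mem_singleton] at hf
    rw [hf]; exact Function.surjective_id
  · rw [hE]; decide

def K2 : List (List Wd) := [
  [[a0, a0], [a1, a1], [a1, a2], [a2, a0]]]

def R2_0 : List Wd := [[a0, a0], [a1, a1], [a1, a2], [a2, a0]]

def wit2 : List (List ℕ × List Wd) := [
  ([0, 0], R2_0),
  ([2, 2], R2_0),
  ([2, 4], R2_0)]

def K3 : List (List Wd) := [
  [[a1, a1, a1], [a1, a2, a0], [a0, a1, a2], [a2, a0, a1], [a2, a2, a2], [a0, a0, a0]]]

def R3_0 : List Wd := [[a1, a1, a1], [a1, a2, a0], [a0, a1, a2], [a2, a0, a1], [a2, a2, a2], [a0, a0, a0]]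

def wit3 : List (List ℕ × List Wd) := [
  ([0, 0, 0], R3_0),
  ([0, 0, 1], R3_0)]

def K48 : List (List Wd) := [
  [[a0, a2, a0, a1], [a1, a0, a0, a0], [a2, a0, a0, a1], [a0, a1, a1, a1], [a1, a2, a2, a2], [a1, a0, a1, a2], [a0, a1, a2, a0], [a2, a1, a2, a2]],
  [[a0, a0, a0, a0], [a0, a1, a1, a1], [a0, a2, a0, a1], [a2, a1, a2, a1], [a1, a2, a2, a2], [a1, a1, a2, a0], [a2, a0, a0, a2], [a1, a0, a1, a2]],
  [[a0, a0, a0, a0], [a2, a0, a2, a0], [a1, a1, a2, a0], [a1, a2, a2, a2], [a1, a2, a0, a1], [a0, a0, a1, a2], [a2, a2, a1, a1], [a0, a1, a1, a1]],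
  [[a1, a0, a1, a2], [a0, a0, a0, a0], [a2, a0, a2, a1], [a0, a2, a2, a2], [a0, a1, a1, a1], [a1, a2, a0, a1], [a1, a1, a2, a0], [a2, a1, a0, a2]]]

def R48_0 : List Wd := [[a0, a2, a0, a1], [a1, a0, a0, a0], [a2, a0, a0, a1], [a0, a1, a1, a1], [a1, a2, a2, a2], [a1, a0, a1, a2], [a0, a1, a2, a0], [a2, a1, a2, a2]]

def R48_1 : List Wd := [[a0, a0, a0, a0], [a0, a1, a1, a1], [a0, a2, a0, a1], [a2, a1, a2, a1], [a1, a2, a2, a2], [a1, a1, a2, a0], [a2, a0, a0, a2], [a1, a0, a1, a2]]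

def R48_2 : List Wd := [[a0, a0, a0, a0], [a2, a0, a2, a0], [a1, a1, a2, a0], [a1, a2, a2, a2], [a1, a2, a0, a1], [a0, a0, a1, a2], [a2, a2, a1, a1], [a0, a1, a1, a1]]

def R48_3 : List Wd := [[a1, a0, a1, a2], [a0, a0, a0, a0], [a2, a0, a2, a1], [a0, a2, a2, a2], [a0, a1, a1, a1], [a1, a2, a0, a1], [a1, a1, a2, a0], [a2, a1, a0, a2]]

def wit48 : List (List ℕ × List Wd) := [
  ([0, 0, 0, 0], R48_0),
  ([0, 0, 0, 0], R48_1),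
  ([0, 1, 2, 5], R48_1),
  ([0, 1, 2, 5], R48_0),
  ([0, 0, 0, 0], R48_2),
  ([0, 0, 0, 0], R48_3),
  ([0, 4, 4, 4], R48_3),
  ([0, 3, 3, 3], R48_2),
  ([0, 2, 5, 1], R48_2),
  ([0, 3, 3, 3], R48_3),
  ([0, 3, 3, 3], R48_1),
  ([0, 5, 1, 2], R48_0)]

def K49 : List (List Wd) := [
  [[a2, a1, a0, a2], [a2, a0, a2, a1], [a2, a2, a1, a0], [a0, a0, a0, a0], [a1, a1, a2, a0], [a1, a0, a1, a2], [a1, a2, a0, a1], [a0, a2, a2, a2], [a0, a1, a1, a1]]]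

def R49_0 : List Wd := [[a2, a1, a0, a2], [a2, a0, a2, a1], [a2, a2, a1, a0], [a0, a0, a0, a0], [a1, a1, a2, a0], [a1, a0, a1, a2], [a1, a2, a0, a1], [a0, a2, a2, a2], [a0, a1, a1, a1]]

def wit49 : List (List ℕ × List Wd) := [
  ([0, 0, 0, 0], R49_0)]


lemma Cov2 : Cov 2 4 K2 :=
  Cov_red (L := [[[0], [1], [2]]].flatMap (ext 1 0))
    (Cov_succ Bnd1 (by norm_num) Cov1 (by norm_num) (by intros; omega)
      (fun r hr P hP => List.mem_flatMap.2 ⟨r, hr, hP⟩)) K2 wit2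
    (by decide +kernel) (by decide +kernel)

lemma Cov3 : Cov 3 6 K3 :=
  Cov_red (L := K2.flatMap (ext 2 1))
    (Cov_succ Bnd2 (by norm_num) Cov2 (by norm_num) (by intros; omega)
      (fun r hr P hP => List.mem_flatMap.2 ⟨r, hr, hP⟩)) K3 wit3
    (by decide +kernel) (by decide +kernel)

lemma Cov48 : Cov 4 8 K48 :=
  Cov_red (L := K3.flatMap (ext 3 1))
    (Cov_succ Bnd3 (by norm_num) Cov3 (by norm_num) (by intros; omega)
      (fun r hr P hP => List.mem_flatMap.2 ⟨r, hr, hP⟩)) K48 wit48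
    (by decide +kernel) (by decide +kernel)

lemma Cov49 : Cov 4 9 K49 :=
  Cov_red (L := K3.flatMap (ext 3 2))
    (Cov_succ Bnd3 (by norm_num) Cov3 (by norm_num) (by intros; omega)
      (fun r hr P hP => List.mem_flatMap.2 ⟨r, hr, hP⟩)) K49 wit49
    (by decide +kernel) (by decide +kernel)

lemma fin8_0 : (ext 4 2 R48_0).isEmpty = true := by decide +kernel

lemma fin8_1 : (ext 4 2 R48_1).isEmpty = true := by decide +kernel

lemma fin8_2 : (ext 4 2 R48_2).isEmpty = true := by decide +kernel

lemma fin8_3 : (ext 4 2 R48_3).isEmpty = true := by decide +kernel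

lemma fin8 : K48.all (fun r => (ext 4 2 r).isEmpty) = true := by
  have h : K48 = [R48_0, R48_1, R48_2, R48_3] := rfl
  rw [h]
  simp only [List.all_cons, List.all_nil, fin8_0, fin8_1, fin8_2, fin8_3, Bool.and_self]

lemma fin9 : K49.all (fun r => (ext 4 1 r).isEmpty) = true := by decide +kernel

lemma Bnd5 : Bnd 5 10 := by
  intro C0 hC0
  by_contra hcon
  obtain ⟨C, hsub, hcard⟩ := Finset.exists_subset_card_eq (show 11 ≤ C0.card by omega)
  have hC : Code 5 C := ⟨fun x hx => hC0.len x (hsub hx), fun x hx y hy z hz =>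
    hC0.tri x (hsub hx) y (hsub hy) z (hsub hz)⟩
  obtain ⟨s, hs⟩ := exists_sym hC
  have hd := Dl_le s Bnd4 (by norm_num) hC
  have hsp := card_split C s
  have hD := Dl_card s hC (by omega)
  rcases (show 9 ≤ (Dl C s).card ∨ 3 ≤ (Ul C s).card by omega) with h | h
  · obtain ⟨σ, r, hr, hg⟩ := Cov49 _ (Dl_code s hC) (by omega)
    obtain ⟨σ', P, hP, -⟩ := ext_good (k := 1) hC hg (by omega)
    have := List.all_eq_true.1 fin9 r hr
    rw [List.isEmpty_iff] at this
    rw [this] at hP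
    simp at hP
  · obtain ⟨σ, r, hr, hg⟩ := Cov48 _ (Dl_code s hC) (by omega)
    obtain ⟨σ', P, hP, -⟩ := ext_good (k := 2) hC hg (by omega)
    have := List.all_eq_true.1 fin8 r hr
    rw [List.isEmpty_iff] at this
    rw [this] at hP
    simp at hP

lemma triff_ofFn : ∀ {n : ℕ} (x y z : Fin n → Fin 3),
    (∃ i, x i ≠ y i ∧ x i ≠ z i ∧ y i ≠ z i) →
    triff (List.ofFn x) (List.ofFn y) (List.ofFn z) = true := by
  intro n
  induction n with
  | zero => rintro x y z ⟨i, _⟩; exact i.elim0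
  | succ n ih =>
    rintro x y z ⟨i, hi⟩
    simp only [List.ofFn_succ, triff_cons, Bool.or_eq_true, rb_iff]
    rcases Fin.eq_zero_or_eq_succ i with rfl | ⟨j, rfl⟩
    · exact Or.inl hi
    · exact Or.inr (ih _ _ _ ⟨j, hi⟩)

end Triff

/-- Every trifferent code of length `5` over the ternary alphabet has at most `10`
codewords: there is no trifferent code of size `11` and length `5`. -/
theorem trifferent_code_length_five_card_le_ten (C : Finset (Fin 5 → Fin 3))
    (hC : ∀ x ∈ C, ∀ y ∈ C, ∀ z ∈ C, x ≠ y → x ≠ z → y ≠ z →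
      ∃ i : Fin 5, x i ≠ y i ∧ x i ≠ z i ∧ y i ≠ z i) :
    C.card ≤ 10 := by
  have hcode : Triff.Code 5 (C.image List.ofFn) := by
    constructor
    · intro x hx
      rw [Finset.mem_image] at hx
      obtain ⟨y, _, rfl⟩ := hx
      simp
    · intro x hx y hy z hz h1 h2 h3
      rw [Finset.mem_image] at hx hy hz
      obtain ⟨x, hx, rfl⟩ := hx
      obtain ⟨y, hy, rfl⟩ := hy
      obtain ⟨z, hz, rfl⟩ := hz
      exact Triff.triff_ofFn x y z (hC x hx y hy z hz (fun e => h1 (by rw [e]))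
        (fun e => h2 (by rw [e])) (fun e => h3 (by rw [e])))
  have h := Triff.Bnd5 _ hcode
  rwa [Finset.card_image_of_injective _ List.ofFn_injective] at h
end
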